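/- arXiv:0805.2977 — 4 statements merged into one kernel-verified Lean document; each statement's English description precedes it below -/
import Mathlib

section
/- The tensor rank of the 2×2 matrix multiplication tensor is at least 7: the four bilinear forms f_{ij} = a_{i0}b_{0j} + a_{i1}b_{1j} cannot all be written as linear combinations of 6 products of linear forms (one in the a-variables, one in the b-variables). -/
namespace Wino

abbrev M := Matrix (Fin 2) (Fin 2) ℂ

lemma finrank_M : Module.finrank ℂ M = 4 := by
  simp [M, Module.finrank_matrix]

/-- If four elements reproduce everything, they are independent. -/
lemma li_of_repr (v : Fin 4 → (M →ₗ[ℂ] ℂ)) (C : Fin 4 → M) (w : Fin 4 → ℂ)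
    (h : ∀ B, B = ∑ l, (w l * v l B) • C l) : LinearIndependent ℂ C := by
  apply linearIndependent_of_top_le_span_of_card_eq_finrank
  · intro B _
    rw [h B]
    exact Submodule.sum_mem _ fun l _ =>
      Submodule.smul_mem _ _ (Submodule.subset_span ⟨l, rfl⟩)
  · rw [finrank_M]; simp

lemma li_zero {C : Fin 4 → M} (hC : LinearIndependent ℂ C) (w : Fin 4 → ℂ)
    (h : ∑ l, w l • C l = 0) (m : Fin 4) : w m = 0 :=
  Fintype.linearIndependent_iff.1 hC w h m

lemma dual_of_repr (v : Fin 4 → (M →ₗ[ℂ] ℂ)) (C : Fin 4 → M) (w : Fin 4 → ℂ)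
    (h : ∀ B, B = ∑ l, (w l * v l B) • C l) (l m : Fin 4) :
    w l * v l (C m) = if l = m then 1 else 0 := by
  have hC := li_of_repr v C w h
  have := li_zero hC (fun l => w l * v l (C m) - if l = m then 1 else 0) (by
    simp only [sub_smul, Finset.sum_sub_distrib, ← h (C m)]
    simp) l
  exact sub_eq_zero.1 this

lemma final_alg (r s r' s' x0 x1 y0 y1 F0 F1 G0 G1 : ℂ)
    (h00 : r * x0 * F0 + s * y0 * G0 = 1) (h01 : r * x0 * F1 + s * y0 * G1 = 0)
    (h10 : r * x1 * F0 + s * y1 * G0 = 0) (h11 : r * x1 * F1 + s * y1 * G1 = 1)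
    (k00 : r' * x0 * F0 + s' * y0 * G0 = 0) (k01 : r' * x0 * F1 + s' * y0 * G1 = 0)
    (k10 : r' * x1 * F0 + s' * y1 * G0 = 0) (k11 : r' * x1 * F1 + s' * y1 * G1 = 0) :
    r' = 0 ∧ s' = 0 := by
  have hd : r * s * ((x0 * y1 - x1 * y0) * (F0 * G1 - F1 * G0)) = 1 := by
    have : (r * x0 * F0 + s * y0 * G0) * (r * x1 * F1 + s * y1 * G1)
      - (r * x0 * F1 + s * y0 * G1) * (r * x1 * F0 + s * y1 * G0) = 1 := by
      rw [h00, h01, h10, h11]; ring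
    linear_combination this
  have hr : r' * ((x0 * y1 - x1 * y0) * (F0 * G1 - F1 * G0)) = 0 := by
    linear_combination y1 * G1 * k00 - y1 * G0 * k01 - y0 * G1 * k10 + y0 * G0 * k11
  have hs : s' * ((x0 * y1 - x1 * y0) * (F0 * G1 - F1 * G0)) = 0 := by
    linear_combination x1 * F1 * k00 - x1 * F0 * k01 - x0 * F1 * k10 + x0 * F0 * k11
  have hne : ((x0 * y1 - x1 * y0) * (F0 * G1 - F1 * G0)) ≠ 0 := by
    intro h0; rw [h0] at hd; simp at hd
  exact ⟨(mul_eq_zero.1 hr).resolve_right hne, (mul_eq_zero.1 hs).resolve_right hne⟩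

lemma final (u v : Fin 4 → (M →ₗ[ℂ] ℂ)) (C : Fin 4 → M) (r s x y : M →ₗ[ℂ] ℂ) (F G : M)
    (h : ∀ A B : M, A * B = ∑ l, (u l A * v l B) • C l + (r A * x B) • F + (s A * y B) • G)
    (hr0 : r !![1,0;0,0] = 0) (hr1 : r !![0,0;0,1] = 0)
    (hs0 : s !![1,0;0,0] = 0) (hs1 : s !![0,0;0,1] = 0) : False := by
  have he : ∀ B : M, !![1,0;0,0] * B = ∑ l, (u l !![1,0;0,0] * v l B) • C l := by
    intro B; rw [h, hr0, hs0]; simp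
  have hf : ∀ B : M, !![0,0;0,1] * B = ∑ l, (u l !![0,0;0,1] * v l B) • C l := by
    intro B; rw [h, hr1, hs1]; simp
  have h1 : ∀ B : M, B = ∑ l, ((u l !![1,0;0,0] + u l !![0,0;0,1]) * v l B) • C l := by
    intro B
    simp only [add_mul, add_smul, Finset.sum_add_distrib, ← he, ← hf]
    rw [← add_mul]
    ext i j; fin_cases i <;> simp [Matrix.mul_apply]
  have hC := li_of_repr v C _ h1
  have hd := dual_of_repr v C _ h1
  have hefB : ∀ (B : M) m, u m !![1,0;0,0] * v m (!![0,0;0,1] * B) = 0 := by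
    intro B
    apply li_zero hC
    rw [← he, ← Matrix.mul_assoc]
    ext i j; fin_cases i <;> simp [Matrix.mul_apply]
  have hfeB : ∀ (B : M) m, u m !![0,0;0,1] * v m (!![1,0;0,0] * B) = 0 := by
    intro B
    apply li_zero hC
    rw [← hf, ← Matrix.mul_assoc]
    ext i j; fin_cases i <;> simp [Matrix.mul_apply]
  -- eigenvector equations
  have hz : ∀ l m, l ≠ m → v l (C m) = 0 := by
    intro l m hlm
    have h1 := hd l m
    have h2 := hd l l
    rw [if_neg hlm] at h1
    rw [if_pos rfl] at h2
    rcases mul_eq_zero.1 h1 with h3 | h3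
    · rw [h3] at h2; simp at h2
    · exact h3
  have heC : ∀ m, !![1,0;0,0] * C m = (u m !![1,0;0,0] * v m (C m)) • C m := by
    intro m
    rw [he, Finset.sum_eq_single m]
    · intro l _ hl; rw [hz l m hl]; simp
    · simp
  have hfC : ∀ m, !![0,0;0,1] * C m = (u m !![0,0;0,1] * v m (C m)) • C m := by
    intro m
    rw [hf, Finset.sum_eq_single m]
    · intro l _ hl; rw [hz l m hl]; simp
    · simp
  have hvC : ∀ m, v m (C m) ≠ 0 := by
    intro m h0
    have := hd m m
    rw [h0] at this; simp at this
  have hne : ∀ m, u m !![1,0;0,0] ≠ 0 ∨ u m !![0,0;0,1] ≠ 0 := by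
    intro m
    by_contra! h0
    have := hd m m
    rw [h0.1, h0.2] at this; simp at this
  have k1 : ∀ m j (B : M), v m (!![1,0;0,0] * B) * C m 1 j = 0 := by
    intro m j B
    rcases hne m with h0 | h0
    · have := congrFun (congrFun (heC m) 1) j
      simp [Matrix.mul_apply, h0, hvC m] at this
      rw [this]; simp
    · rw [(mul_eq_zero.1 (hfeB B m)).resolve_left h0]; simp
  have k0 : ∀ m j (B : M), v m (!![0,0;0,1] * B) * C m 0 j = 0 := by
    intro m j B
    rcases hne m with h0 | h0
    · rw [(mul_eq_zero.1 (hefB B m)).resolve_left h0]; simp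
    · have := congrFun (congrFun (hfC m) 0) j
      simp [Matrix.mul_apply, h0, hvC m] at this
      rw [this]; simp
  have e1 : ∀ (A B : M) j, (A * (!![1,0;0,0] * B) : M) 1 j =
      r A * x (!![1,0;0,0] * B) * F 1 j + s A * y (!![1,0;0,0] * B) * G 1 j := by
    intro A B j
    rw [h A (!![1,0;0,0] * B)]
    simp only [Matrix.add_apply, Matrix.sum_apply, Matrix.smul_apply, smul_eq_mul, mul_assoc, k1]
    simp
  have e0 : ∀ (A B : M) j, (A * (!![0,0;0,1] * B) : M) 0 j =
      r A * x (!![0,0;0,1] * B) * F 0 j + s A * y (!![0,0;0,1] * B) * G 0 j := by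
    intro A B j
    rw [h A (!![0,0;0,1] * B)]
    simp only [Matrix.add_apply, Matrix.sum_apply, Matrix.smul_apply, smul_eq_mul, mul_assoc, k0]
    simp
  have key := final_alg (r !![0,0;1,0]) (s !![0,0;1,0]) (r !![0,1;0,0]) (s !![0,1;0,0])
    (x (!![1,0;0,0] * !![1,0;0,0])) (x (!![1,0;0,0] * !![0,1;0,0]))
    (y (!![1,0;0,0] * !![1,0;0,0])) (y (!![1,0;0,0] * !![0,1;0,0]))
    (F 1 0) (F 1 1) (G 1 0) (G 1 1)
    (by rw [← e1]; simp) (by rw [← e1]; simp)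
    (by rw [← e1]; simp) (by rw [← e1]; simp)
    (by rw [← e1]; simp) (by rw [← e1]; simp)
    (by rw [← e1]; simp) (by rw [← e1]; simp)
  have := e0 !![0,1;0,0] !![0,0;1,0] 0
  rw [key.1, key.2] at this
  simp at this

lemma exists_col (C : M) (hC : C ≠ 0) : ∃ j, C 0 j ≠ 0 ∨ C 1 j ≠ 0 := by
  by_contra! h
  apply hC
  ext i j
  fin_cases i
  · exact (h j).1
  · exact (h j).2

lemma pencil (u v : Fin 4 → (M →ₗ[ℂ] ℂ)) (C : Fin 4 → M) (r s x y : M →ₗ[ℂ] ℂ) (F G : M)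
    (h : ∀ A B : M, A * B = ∑ l, (u l A * v l B) • C l + (r A * x B) • F + (s A * y B) • G)
    (A₀ X : M) (hA : IsUnit A₀.det) (hX : ∀ t : ℂ, X ≠ t • A₀)
    (hr0 : r A₀ = 0) (hr1 : r X = 0) (hs0 : s A₀ = 0) (hs1 : s X = 0) : False := by
  have h1 : ∀ B : M, B = ∑ l, (u l A₀ * v l B) • (A₀⁻¹ * C l) := by
    intro B
    have := h A₀ B
    rw [hr0, hs0] at this
    simp only [zero_mul, zero_smul, add_zero] at this
    calc B = A₀⁻¹ * (A₀ * B) := by rw [← Matrix.mul_assoc, Matrix.nonsing_inv_mul _ hA, one_mul]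
      _ = _ := by rw [this, Finset.mul_sum]; simp only [Matrix.mul_smul]
  have h2 : ∀ B : M, A₀⁻¹ * X * B = ∑ l, (u l X * v l B) • (A₀⁻¹ * C l) := by
    intro B
    rw [Matrix.mul_assoc, h X B, hr1, hs1]
    simp only [zero_mul, zero_smul, add_zero, Finset.mul_sum, Matrix.mul_smul]
  set D : Fin 4 → M := fun l => A₀⁻¹ * C l with hD
  have hli := li_of_repr v D _ h1
  have hd := dual_of_repr v D _ h1
  have hz : ∀ l m, l ≠ m → v l (D m) = 0 := by
    intro l m hlm
    have h1 := hd l m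
    have h2 := hd l l
    rw [if_neg hlm] at h1
    rw [if_pos rfl] at h2
    rcases mul_eq_zero.1 h1 with h3 | h3
    · rw [h3] at h2; simp at h2
    · exact h3
  obtain ⟨lam, hlam⟩ : ∃ lam : Fin 4 → ℂ, ∀ m, A₀⁻¹ * X * D m = lam m • D m := by
    refine ⟨fun m => u m X * v m (D m), fun m => ?_⟩
    rw [h2, Finset.sum_eq_single m]
    · intro l _ hl; rw [hz l m hl]; simp
    · simp
  have hex : ∃ m, lam m ≠ lam 0 := by
    by_contra! hall
    apply hX (lam 0)
    have : A₀⁻¹ * X = lam 0 • (1 : M) := by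
      have e := h1 1
      calc A₀⁻¹ * X = A₀⁻¹ * X * 1 := by rw [mul_one]
        _ = A₀⁻¹ * X * ∑ l, (u l A₀ * v l 1) • D l := by rw [← e]
        _ = lam 0 • ∑ l, (u l A₀ * v l 1) • D l := by
          rw [Finset.mul_sum, Finset.smul_sum]
          refine Finset.sum_congr rfl fun l _ => ?_
          rw [Matrix.mul_smul, hlam, hall, smul_comm]
        _ = _ := by rw [← e]
    calc X = A₀ * (A₀⁻¹ * X) := by rw [← Matrix.mul_assoc, Matrix.mul_nonsing_inv _ hA, one_mul]
      _ = _ := by rw [this]; simp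
  obtain ⟨m, hm⟩ := hex
  obtain ⟨j, hj⟩ := exists_col (D 0) (hli.ne_zero 0)
  obtain ⟨k, hk⟩ := exists_col (D m) (hli.ne_zero m)
  have a0 := congrFun (congrFun (hlam 0) 0) j
  have a1 := congrFun (congrFun (hlam 0) 1) j
  have b0 := congrFun (congrFun (hlam m) 0) k
  have b1 := congrFun (congrFun (hlam m) 1) k
  set Y : M := A₀⁻¹ * X with hY
  rw [Matrix.mul_apply, Fin.sum_univ_two, Matrix.smul_apply, smul_eq_mul] at a0 a1 b0 b1
  generalize lam 0 = α at *
  generalize lam m = β at *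
  set P : M := !![D 0 0 j, D m 0 k; D 0 1 j, D m 1 k] with hP
  have hYP : Y * P = P * !![α, 0; 0, β] := by
    ext a b
    fin_cases a <;> fin_cases b <;> simp [Matrix.mul_apply, hP] <;>
      first | linear_combination a0 | linear_combination a1 | linear_combination b0 | linear_combination b1
  have hdet : IsUnit P.det := by
    rw [isUnit_iff_ne_zero, hP, Matrix.det_fin_two_of]
    intro h0
    have hsub : β - α ≠ 0 := sub_ne_zero.2 hm
    generalize D 0 0 j = p at *
    generalize D 0 1 j = q at *
    generalize D m 0 k = p' at *
    generalize D m 1 k = q' at *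
    have z1 : (β - α) * (p * p') = 0 := by
      linear_combination (-p) * b0 + p' * a0 + Y 0 1 * h0
    have z2 : (β - α) * (q * q') = 0 := by
      linear_combination (-q) * b1 + q' * a1 - Y 1 0 * h0
    have z3 : (β - α) * (p * q') = 0 := by
      linear_combination (-p) * b1 + p' * a1 + (Y 1 1 - α) * h0
    have z4 : (β - α) * (q * p') = 0 := by
      linear_combination (-q) * b0 + q' * a0 + (α - Y 0 0) * h0
    have z1 := (mul_eq_zero.1 z1).resolve_left hsub
    have z2 := (mul_eq_zero.1 z2).resolve_left hsub
    have z3 := (mul_eq_zero.1 z3).resolve_left hsub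
    have z4 := (mul_eq_zero.1 z4).resolve_left hsub
    simp only [mul_eq_zero] at z1 z2 z3 z4
    tauto
  -- change of coordinates
  let L : M →ₗ[ℂ] M := LinearMap.mulLeft ℂ (A₀ * P) ∘ₗ LinearMap.mulRight ℂ P⁻¹
  have hL : ∀ A, L A = A₀ * P * (A * P⁻¹) := fun A => rfl
  let R : M →ₗ[ℂ] M := LinearMap.mulLeft ℂ P
  have hR : ∀ A, R A = P * A := fun A => rfl
  have hL1 : L 1 = A₀ := by
    rw [hL, one_mul, Matrix.mul_assoc, Matrix.mul_nonsing_inv _ hdet, mul_one]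
  have hL2 : L !![α, 0; 0, β] = X := by
    rw [hL, Matrix.mul_assoc, ← Matrix.mul_assoc P, ← hYP, Matrix.mul_assoc Y,
      Matrix.mul_nonsing_inv _ hdet, mul_one, hY, ← Matrix.mul_assoc,
      Matrix.mul_nonsing_inv _ hA, one_mul]
  have hsub : α - β ≠ 0 := sub_ne_zero.2 (Ne.symm hm)
  have hE : (!![1,0;0,0] : M) = (α - β)⁻¹ • (!![α, 0; 0, β] - β • (1 : M)) := by
    ext a b; fin_cases a <;> fin_cases b <;> simp [hsub]
  have hE' : (!![0,0;0,1] : M) = (α - β)⁻¹ • (α • (1 : M) - !![α, 0; 0, β]) := by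
    ext a b; fin_cases a <;> fin_cases b <;> simp [hsub]
  refine final (fun l => u l ∘ₗ L) (fun l => v l ∘ₗ R) (fun l => P⁻¹ * A₀⁻¹ * C l)
    (r ∘ₗ L) (s ∘ₗ L) (x ∘ₗ R) (y ∘ₗ R) (P⁻¹ * A₀⁻¹ * F) (P⁻¹ * A₀⁻¹ * G) ?_ ?_ ?_ ?_ ?_
  · intro A B
    have e : A * B = P⁻¹ * A₀⁻¹ * (L A * R B) := by
      rw [hL, hR]
      calc A * B = (P⁻¹ * (A₀⁻¹ * A₀) * P) * A * (P⁻¹ * P) * B := by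
            simp [Matrix.nonsing_inv_mul _ hA, Matrix.nonsing_inv_mul _ hdet]
        _ = _ := by simp only [Matrix.mul_assoc]
    rw [e, h (L A) (R B)]
    simp only [Matrix.mul_add, Finset.mul_sum, Matrix.mul_smul, LinearMap.comp_apply]
  · rw [hE]; simp only [LinearMap.comp_apply, map_smul, map_sub, hL1, hL2, hr0, hr1]; simp
  · rw [hE']; simp only [LinearMap.comp_apply, map_smul, map_sub, hL1, hL2, hr0, hr1]; simp
  · rw [hE]; simp only [LinearMap.comp_apply, map_smul, map_sub, hL1, hL2, hs0, hs1]; simp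
  · rw [hE']; simp only [LinearMap.comp_apply, map_smul, map_sub, hL1, hL2, hs0, hs1]; simp

lemma exists_perm : ∀ i j : Fin 6, i ≠ j → ∃ σ : Equiv.Perm (Fin 6), σ 4 = i ∧ σ 5 = j := by
  intro i j hij
  refine ⟨Equiv.swap 4 i * Equiv.swap 5 (Equiv.swap 4 i j), ?_⟩
  revert i j
  decide

lemma exists_compl : ∀ k l : Fin 4, k ≠ l → ∃ i j : Fin 4, i ≠ j ∧
    i ≠ k ∧ i ≠ l ∧ j ≠ k ∧ j ≠ l := by
  decide

lemma pencil6 (u v : Fin 6 → (M →ₗ[ℂ] ℂ)) (C : Fin 6 → M)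
    (h : ∀ A B : M, A * B = ∑ l, (u l A * v l B) • C l) (i j : Fin 6) (hij : i ≠ j)
    (A₀ X : M) (hA : IsUnit A₀.det) (hX : ∀ t : ℂ, X ≠ t • A₀)
    (hr0 : u i A₀ = 0) (hr1 : u i X = 0) (hs0 : u j A₀ = 0) (hs1 : u j X = 0) : False := by
  obtain ⟨σ, h4, h5⟩ := exists_perm i j hij
  refine pencil (fun l => u (σ (l.castAdd 2))) (fun l => v (σ (l.castAdd 2)))
    (fun l => C (σ (l.castAdd 2))) (u i) (u j) (v i) (v j) (C i) (C j) ?_ A₀ X hA hX hr0 hr1 hs0 hs1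
  intro A B
  rw [h A B, ← Equiv.sum_comp σ, Fin.sum_univ_six, Fin.sum_univ_four, h4, h5]
  rfl

def polar (X Y : M) : ℂ := X 0 0 * Y 1 1 + Y 0 0 * X 1 1 - X 0 1 * Y 1 0 - Y 0 1 * X 1 0

lemma no6 (u v : Fin 6 → (M →ₗ[ℂ] ℂ)) (C : Fin 6 → M)
    (h : ∀ A B : M, A * B = ∑ l, (u l A * v l B) • C l) : False := by
  have hinj : ∀ A, (∀ l, u l A = 0) → A = 0 := by
    intro A hA
    have := h A 1
    simpa [hA] using this
  have hspan : Submodule.span ℂ (Set.range u) = ⊤ := by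
    rw [eq_top_iff]
    intro φ _
    apply mem_span_of_iInf_ker_le_ker
    intro A hA
    simp only [Submodule.mem_iInf, LinearMap.mem_ker] at hA
    rw [hinj A hA]; simp
  obtain ⟨κ, a, ha, hsp, hli⟩ := exists_linearIndependent' ℂ u
  have : Finite κ := Finite.of_injective a ha
  have := Fintype.ofFinite κ
  have hcard : Fintype.card κ = 4 := by
    have h1 := finrank_span_eq_card hli
    rw [hsp, hspan, finrank_top] at h1
    have h2 : Module.finrank ℂ (M →ₗ[ℂ] ℂ) = Module.finrank ℂ M := Subspace.dual_finrank_eq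
    rw [finrank_M] at h2
    omega
  let e : Fin 4 ≃ κ := (Fintype.equivFinOfCardEq hcard).symm
  let g : Fin 4 → Fin 6 := a ∘ e
  have hg : Function.Injective g := ha.comp e.injective
  let Φ : M →ₗ[ℂ] (Fin 4 → ℂ) := LinearMap.pi (fun k => u (g k))
  have hΦ : Function.Injective Φ := by
    rw [injective_iff_map_eq_zero]
    intro A hA
    have hk : ∀ k, u (a k) A = 0 := by
      intro k
      have := congrFun hA (e.symm k)
      simpa [Φ, g] using this
    apply hinj
    intro l
    have hl : u l ∈ Submodule.span ℂ (Set.range (u ∘ a)) := by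
      rw [hsp, hspan]; trivial
    have hle : Submodule.span ℂ (Set.range (u ∘ a)) ≤
        LinearMap.ker (LinearMap.applyₗ (R := ℂ) (M₂ := ℂ) A) := by
      rw [Submodule.span_le]
      rintro _ ⟨k, rfl⟩
      simpa using hk k
    simpa using hle hl
  have hsurj : Function.Surjective Φ :=
    (LinearMap.injective_iff_surjective_of_finrank_eq_finrank (by rw [finrank_M]; simp)).1 hΦ
  choose Ψ hΨ using hsurj
  let a' : Fin 4 → M := fun k => Ψ (Pi.single k 1)
  have hu : ∀ l k, u (g l) (a' k) = if l = k then 1 else 0 := by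
    intro l k
    have := congrFun (hΨ (Pi.single k 1)) l
    simpa [Φ, Pi.single_apply] using this
  have hrep : ∀ A, A = ∑ k, u (g k) A • a' k := by
    intro A
    apply hΦ
    ext l
    simp [Φ, hu]
  -- a pair with nondegenerate pencil
  have hp : ∃ k l, polar (a' k) (a' l) ≠ 0 := by
    by_contra! h0
    have e := hrep 1
    have e00 := congrFun (congrFun e 0) 0
    have e01 := congrFun (congrFun e 0) 1
    have e10 := congrFun (congrFun e 1) 0
    have e11 := congrFun (congrFun e 1) 1
    have : (2 : ℂ) = ∑ k, ∑ l, u (g k) 1 * u (g l) 1 * polar (a' k) (a' l) := by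
      have : (2 : ℂ) = polar 1 1 := by simp [polar]; norm_num
      rw [this]
      conv_lhs => rw [e]
      simp only [polar, Matrix.sum_apply, Matrix.smul_apply, smul_eq_mul, Fin.sum_univ_four]
      ring
    simp [h0] at this
  have done : ∀ k l : Fin 4, k ≠ l → ∀ p q p' q' : ℂ, p * q' - q * p' ≠ 0 →
      (p • a' k + q • a' l).det ≠ 0 → False := by
    intro k l hkl p q p' q' hpq hdet
    obtain ⟨i, j, hij, hik, hil, hjk, hjl⟩ := exists_compl k l hkl
    refine pencil6 u v C h (g i) (g j) (hg.ne hij) (p • a' k + q • a' l) (p' • a' k + q' • a' l)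
      (isUnit_iff_ne_zero.2 hdet) ?_ ?_ ?_ ?_ ?_
    · intro t ht
      have h1 := congrArg (u (g k)) ht
      have h2 := congrArg (u (g l)) ht
      simp [hu, hkl, hkl.symm] at h1 h2
      apply hpq
      rw [h1, h2]; ring
    all_goals simp [hu, hik, hil, hjk, hjl]
  obtain ⟨k, l, hkl⟩ := hp
  have hdk : ∀ k, (a' k).det = 0 := by
    intro k
    by_contra h0
    obtain ⟨l, hl⟩ : ∃ l, k ≠ l := by clear h0; revert k; decide
    exact done k l hl 1 0 0 1 (by simp) (by simpa using h0)
  have hne : k ≠ l := by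
    rintro rfl
    apply hkl
    have := hdk k
    rw [Matrix.det_fin_two] at this
    simp only [polar]
    linear_combination 2 * this
  refine done k l hne 1 1 0 1 (by simp) ?_
  intro h0
  apply hkl
  have h1 := hdk k
  have h2 := hdk l
  rw [Matrix.det_fin_two] at h0 h1 h2
  simp at h0
  simp only [polar]
  linear_combination h0 - h1 - h2

/-- The linear form with given coefficients. -/
def form (w : Fin 2 → Fin 2 → ℂ) : M →ₗ[ℂ] ℂ where
  toFun A := ∑ p, ∑ q, w p q * A p q
  map_add' A B := by simp [mul_add, Finset.sum_add_distrib]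
  map_smul' t A := by simp [Fin.sum_univ_two]; ring

end Wino

/-- Winograd: 2×2 matrix multiplication cannot be done with 6 non-scalar multiplications. -/
theorem winograd_lower_bound :
    ¬ ∃ (u v : Fin 6 → Fin 2 → Fin 2 → ℂ) (c : Fin 2 → Fin 2 → Fin 6 → ℂ),
      ∀ (a b : Fin 2 → Fin 2 → ℂ) (i j : Fin 2),
        (∑ k, a i k * b k j) =
          ∑ l, c i j l * (∑ p, ∑ q, u l p q * a p q) * (∑ p, ∑ q, v l p q * b p q) := by
  rintro ⟨u, v, c, h⟩
  refine Wino.no6 (fun l => Wino.form (u l)) (fun l => Wino.form (v l))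
    (fun l => Matrix.of fun i j => c i j l) ?_
  intro A B
  ext i j
  rw [Matrix.mul_apply, h A B i j, Matrix.sum_apply]
  refine Finset.sum_congr rfl fun l _ => ?_
  simp only [Matrix.smul_apply, smul_eq_mul, Matrix.of_apply]
  change _ = (∑ p, ∑ q, u l p q * A p q) * (∑ p, ∑ q, v l p q * B p q) * c i j l
  ring
end

section
/- The tensor rank of a tripartite tensor |φ⟩ ∈ H_A ⊗ H_B ⊗ H_C equals the minimum number r of product vectors |α_j⟩⊗|β_j⟩ ∈ H_A ⊗ H_B whose linear span contains the support of the reduced operator ρ_{AB} = Tr_C(|φ⟩⟨φ|). -/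
/-- Tensor rank of a tripartite tensor: minimum number of elementary tensors summing to it. -/
noncomputable def trank {ιA ιB ιC : Type*} (φ : ιA → ιB → ιC → ℂ) : ℕ :=
  sInf {r : ℕ | ∃ (a : Fin r → ιA → ℂ) (b : Fin r → ιB → ℂ) (c : Fin r → ιC → ℂ),
    ∀ i j k, φ i j k = ∑ l, a l i * b l j * c l k}

theorem range_reduced_eq (nA nB nC : ℕ) (φ : Fin nA → Fin nB → Fin nC → ℂ) :
    LinearMap.range (Matrix.toLin' (Matrix.of fun p q : Fin nA × Fin nB =>
          ∑ k, φ p.1 p.2 k * (starRingEnd ℂ) (φ q.1 q.2 k))) =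
      Submodule.span ℂ (Set.range fun k => fun p : Fin nA × Fin nB => φ p.1 p.2 k) := by
  set N : Matrix (Fin nA × Fin nB) (Fin nC) ℂ := Matrix.of fun p k => φ p.1 p.2 k with hN
  have hM : (Matrix.of fun p q : Fin nA × Fin nB =>
      ∑ k, φ p.1 p.2 k * (starRingEnd ℂ) (φ q.1 q.2 k)) = N * N.conjTranspose := by
    ext p q
    simp [hN, Matrix.mul_apply]
  have hcol : Submodule.span ℂ (Set.range fun k => fun p : Fin nA × Fin nB => φ p.1 p.2 k)
      = LinearMap.range N.mulVecLin := by
    rw [Matrix.range_mulVecLin]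
    rfl
  rw [hM, hcol, Matrix.toLin'_apply']
  apply Submodule.eq_of_le_of_finrank_eq
  · rw [Matrix.mulVecLin_mul]
    exact LinearMap.range_comp_le_range _ _
  · open ComplexOrder in exact Matrix.rank_self_mul_conjTranspose N

/-- The tensor rank of φ equals the minimum number of product vectors in H_A ⊗ H_B whose
span contains the support (= range) of the reduced operator ρ_AB = Tr_C |φ⟩⟨φ|. -/
theorem trank_eq_min_product_span_support (nA nB nC : ℕ)
    (φ : Fin nA → Fin nB → Fin nC → ℂ) :
    trank φ = sInf {r : ℕ | ∃ (α : Fin r → Fin nA → ℂ) (β : Fin r → Fin nB → ℂ),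
      LinearMap.range (Matrix.toLin' (Matrix.of fun p q : Fin nA × Fin nB =>
          ∑ k, φ p.1 p.2 k * (starRingEnd ℂ) (φ q.1 q.2 k))) ≤
        Submodule.span ℂ (Set.range fun l => fun p : Fin nA × Fin nB => α l p.1 * β l p.2)} := by
  rw [range_reduced_eq, trank]
  congr 1
  ext r
  simp only [Set.mem_ofPred_eq, Submodule.span_le, Set.range_subset_iff, SetLike.mem_coe,
    Submodule.mem_span_range_iff_exists_fun]
  constructor
  · rintro ⟨a, b, c, h⟩
    refine ⟨a, b, fun k => ⟨fun l => c l k, ?_⟩⟩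
    ext p
    simp only [Finset.sum_apply, Pi.smul_apply, smul_eq_mul, h]
    exact Finset.sum_congr rfl fun l _ => by ring
  · rintro ⟨a, b, h⟩
    choose c hc using h
    refine ⟨a, b, fun l k => c k l, fun i j k => ?_⟩
    have := congrFun (hc k) (i, j)
    simp only [Finset.sum_apply, Pi.smul_apply, smul_eq_mul] at this
    rw [← this]
    exact Finset.sum_congr rfl fun l _ => by ring
end

section
/- The tripartite state |Φ^3⟩ = |Φ⟩_{AB}|Φ⟩_{AC}|Φ⟩_{BC}, a triangle of three EPR pairs, has tensor rank exactly 7 when viewed as a tripartite tensor in (ℂ^2⊗ℂ^2)^{⊗3}. -/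
/-- The triangle of three EPR pairs: Φ³ = Σ_{i,j,k} |ij⟩_A |jk⟩_B |ki⟩_C. -/
def Phi3 : (Fin 2 × Fin 2) → (Fin 2 × Fin 2) → (Fin 2 × Fin 2) → ℂ :=
  fun a b c => if a.2 = b.1 ∧ b.2 = c.1 ∧ c.2 = a.1 then 1 else 0

/-- Three linear functionals on `2 × 2` matrices have a common nonzero zero. -/
theorem exists_common_zero (p q s : Matrix (Fin 2) (Fin 2) ℂ →ₗ[ℂ] ℂ) :
    ∃ X, X ≠ 0 ∧ p X = 0 ∧ q X = 0 ∧ s X = 0 := by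
  have h : LinearMap.ker (p.prod (q.prod s)) ≠ ⊥ := by
    apply LinearMap.ker_ne_bot_of_finrank_lt
    simp [Module.finrank_prod, Module.finrank_matrix]
  obtain ⟨X, hX, h0⟩ := Submodule.exists_mem_ne_zero_of_ne_bot h
  have h1 : (p X, q X, s X) = (0, 0, 0) := hX
  simp only [Prod.mk.injEq] at h1
  exact ⟨X, h0, h1.1, h1.2.1, h1.2.2⟩

/-- Left multiplication by a nonzero matrix does not have range in the span of `C` and `D C`. -/
theorem left_mul_eq_zero (N D C : Matrix (Fin 2) (Fin 2) ℂ)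
    (a b : Matrix (Fin 2) (Fin 2) ℂ →ₗ[ℂ] ℂ)
    (h : ∀ Y, N * Y = a Y • (D * C) - b Y • C) : N = 0 := by
  by_contra hN
  obtain ⟨v, hv⟩ : ∃ v, N.mulVec v ≠ 0 := by
    by_contra hc
    push Not at hc
    exact hN (Matrix.ext_of_mulVec_single fun i => by rw [hc, Matrix.zero_mulVec])
  -- a nonzero row `w` with `a (v w) = 0`
  obtain ⟨w, hw, haw⟩ : ∃ w : Fin 2 → ℂ, w ≠ 0 ∧ a (Matrix.vecMulVec v w) = 0 := by
    have hadd : ∀ w, a (Matrix.vecMulVec v w) =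
        w 0 * a (Matrix.vecMulVec v ![1, 0]) + w 1 * a (Matrix.vecMulVec v ![0, 1]) := by
      intro w
      rw [← smul_eq_mul, ← smul_eq_mul, ← map_smul, ← map_smul, ← map_add]
      congr 1
      ext i j
      fin_cases j <;> simp [Matrix.vecMulVec_apply, mul_comm]
    by_cases h1 : a (Matrix.vecMulVec v ![1, 0]) = 0
    · exact ⟨![1, 0], fun h => by simpa using congrFun h 0, h1⟩
    · refine ⟨![a (Matrix.vecMulVec v ![0, 1]), - a (Matrix.vecMulVec v ![1, 0])], fun h => h1 ?_, ?_⟩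
      · simpa using congrFun h 1
      · rw [hadd]; simp; ring
  have e1 := h (Matrix.vecMulVec v w)
  rw [haw, zero_smul, zero_sub, Matrix.mul_vecMulVec] at e1
  set z : Fin 2 → ℂ := ![w 1, - w 0] with hz
  have hwz : w ⬝ᵥ z = 0 := by simp [hz, dotProduct, Fin.sum_univ_two]; ring
  have hz0 : z ≠ 0 := by
    intro h0
    apply hw
    ext i
    fin_cases i
    · simpa [hz] using congrFun h0 1
    · simpa [hz] using congrFun h0 0
  have hb : b (Matrix.vecMulVec v w) ≠ 0 := by
    intro hb
    rw [hb, zero_smul, neg_zero, Matrix.vecMulVec_eq_zero] at e1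
    tauto
  have hC : C.mulVec z = 0 := by
    have e2 := congrArg (fun M => Matrix.mulVec M z) e1
    simp only [Matrix.vecMulVec_mulVec, hwz, Matrix.neg_mulVec, Matrix.smul_mulVec] at e2
    have e3 : b (Matrix.vecMulVec v w) • C.mulVec z = 0 := by
      rw [← neg_eq_zero, ← e2]; simp
    exact (smul_eq_zero.mp e3).resolve_left hb
  have hY : ∀ Y, N.mulVec (Matrix.mulVec Y z) = 0 := by
    intro Y
    rw [Matrix.mulVec_mulVec, h Y, Matrix.sub_mulVec, Matrix.smul_mulVec, Matrix.smul_mulVec,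
      ← Matrix.mulVec_mulVec, hC]
    simp
  obtain ⟨i, hi⟩ := Function.ne_iff.mp hz0
  have e4 := hY (Matrix.vecMulVec v (Pi.single i 1))
  rw [Matrix.vecMulVec_mulVec] at e4
  simp only [single_dotProduct, one_mul, Matrix.mulVec_smul, op_smul_eq_smul, smul_eq_zero] at e4
  exact e4.elim hi hv

/-- Given a separating family of functionals, two of them vanish on an invertible matrix. -/
theorem exists_pair (f : Fin 6 → (Matrix (Fin 2) (Fin 2) ℂ →ₗ[ℂ] ℂ))
    (hf : ∀ X, (∀ l, f l X = 0) → X = 0) :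
    ∃ i j X, i ≠ j ∧ Matrix.det X ≠ 0 ∧ f i X = 0 ∧ f j X = 0 := by
  obtain ⟨κ, σ, hσ, hspan, hli⟩ := exists_linearIndependent' ℂ f
  have : Finite κ := Finite.of_injective σ hσ
  have := Fintype.ofFinite κ
  classical
  let T : Matrix (Fin 2) (Fin 2) ℂ →ₗ[ℂ] (κ → ℂ) := LinearMap.pi (fun k => f (σ k))
  have hT : Function.Injective T := by
    rw [← LinearMap.ker_eq_bot, LinearMap.ker_eq_bot']
    intro X hX
    apply hf
    intro l
    have hl : f l ∈ Submodule.span ℂ (Set.range (f ∘ σ)) := by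
      rw [hspan]; exact Submodule.subset_span ⟨l, rfl⟩
    generalize f l = φ at hl
    induction hl using Submodule.span_induction with
    | mem x hx => obtain ⟨k, rfl⟩ := hx; exact congrFun hX k
    | zero => rfl
    | add x y _ _ hx hy => simp [hx, hy]
    | smul c x _ hx => simp [hx]
  have c1 : Fintype.card κ ≤ 4 := by
    have := hli.fintype_card_le_finrank
    simpa [Module.finrank_linearMap, Module.finrank_matrix] using this
  have c2 : 4 ≤ Fintype.card κ := by
    have := LinearMap.finrank_le_finrank_of_injective hT
    simpa [Module.finrank_matrix] using this
  have c3 : Fintype.card κ = 4 := le_antisymm c1 c2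
  have hdim : Module.finrank ℂ (Matrix (Fin 2) (Fin 2) ℂ) = Module.finrank ℂ (κ → ℂ) := by
    simp [Module.finrank_matrix, c3]
  have hsurj : Function.Surjective T :=
    (LinearMap.injective_iff_surjective_of_finrank_eq_finrank hdim).mp hT
  let ε : Fin 4 ≃ κ := (Fintype.equivFinOfCardEq c3).symm
  choose e he using fun k : Fin 4 => hsurj (Pi.single (ε k) (T 1 (ε k)))
  have he' : ∀ k m, m ≠ k → f (σ (ε m)) (e k) = 0 := by
    intro k m hmk
    have := congrFun (he k) (ε m)
    rw [Pi.single_eq_of_ne (by simpa using hmk)] at this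
    exact this
  have hsum : e 0 + e 1 + e 2 + e 3 = 1 := by
    apply hT
    have h1 : T 1 = ∑ k : Fin 4, Pi.single (ε k) (T 1 (ε k)) := by
      rw [Equiv.sum_comp ε (fun k => Pi.single k (T 1 k)), Finset.univ_sum_single]
    rw [h1, Fin.sum_univ_four]
    simp only [map_add, he]
  by_contra hcon
  push Not at hcon
  have key : ∀ m n X, m ≠ n → f (σ (ε m)) X = 0 → f (σ (ε n)) X = 0 → Matrix.det X = 0 := by
    intro m n X hmn h1 h2
    by_contra h3
    exact hcon (σ (ε m)) (σ (ε n)) X (fun h => hmn (ε.injective (hσ h))) h3 h1 h2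
  have k2 : ∀ k l m n, m ≠ n → m ≠ k → m ≠ l → n ≠ k → n ≠ l → Matrix.det (e k + e l) = 0 := by
    intro k l m n h1 h2 h3 h4 h5
    apply key m n _ h1
    · rw [map_add, he' k m h2, he' l m h3, add_zero]
    · rw [map_add, he' k n h4, he' l n h5, add_zero]
  have k1 : ∀ k m n, m ≠ n → m ≠ k → n ≠ k → Matrix.det (e k) = 0 := by
    intro k m n h1 h2 h3
    exact key m n _ h1 (he' k m h2) (he' k n h3)
  have d01 := k2 0 1 2 3 (by decide) (by decide) (by decide) (by decide) (by decide)
  have d02 := k2 0 2 1 3 (by decide) (by decide) (by decide) (by decide) (by decide)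
  have d03 := k2 0 3 1 2 (by decide) (by decide) (by decide) (by decide) (by decide)
  have d12 := k2 1 2 0 3 (by decide) (by decide) (by decide) (by decide) (by decide)
  have d13 := k2 1 3 0 2 (by decide) (by decide) (by decide) (by decide) (by decide)
  have d23 := k2 2 3 0 1 (by decide) (by decide) (by decide) (by decide) (by decide)
  have d0 := k1 0 1 2 (by decide) (by decide) (by decide)
  have d1 := k1 1 0 2 (by decide) (by decide) (by decide)
  have d2 := k1 2 0 1 (by decide) (by decide) (by decide)
  have d3 := k1 3 0 1 (by decide) (by decide) (by decide)
  have dI : Matrix.det (e 0 + e 1 + e 2 + e 3) = 1 := by rw [hsum, Matrix.det_one]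
  simp only [Matrix.det_fin_two, Matrix.add_apply] at *
  have : (1 : ℂ) = 0 := by
    linear_combination -dI + d01 + d02 + d03 + d12 + d13 + d23 - 2 * (d0 + d1 + d2 + d3)
  exact one_ne_zero this

/-- The kernel of a functional contains a matrix not commuting with a given nonscalar one. -/
theorem exists_noncommuting (D : Matrix (Fin 2) (Fin 2) ℂ) (hD : D ≠ 0) (hD0 : D 0 0 = 0)
    (p : Matrix (Fin 2) (Fin 2) ℂ →ₗ[ℂ] ℂ) : ∃ X, p X = 0 ∧ D * X - X * D ≠ 0 := by
  by_contra hcon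
  push Not at hcon
  have hc : ∀ X, p X = 0 → D 0 1 * X 1 0 = X 0 1 * D 1 0 ∧
      D 0 1 * X 1 1 = X 0 0 * D 0 1 + X 0 1 * D 1 1 ∧
      D 1 0 * X 0 0 + D 1 1 * X 1 0 = X 1 1 * D 1 0 := by
    intro X hX
    have h := hcon X hX
    have h00 := congrFun (congrFun h 0) 0
    have h01 := congrFun (congrFun h 0) 1
    have h10 := congrFun (congrFun h 1) 0
    simp only [Matrix.sub_apply, Matrix.mul_apply, Fin.sum_univ_two, Matrix.zero_apply, hD0]
      at h00 h01 h10
    refine ⟨?_, ?_, ?_⟩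
    · linear_combination h00
    · linear_combination h01
    · linear_combination h10
  by_cases hb : D 0 1 = 0
  · by_cases hcc : D 1 0 = 0
    · have hd : D 1 1 ≠ 0 := by
        intro hd
        apply hD
        ext i j
        fin_cases i <;> fin_cases j <;> simp [hD0, hb, hcc, hd]
      obtain ⟨X, hX, h1, h2, h3⟩ := exists_common_zero p (Matrix.entryLinearMap ℂ ℂ 0 0)
        (Matrix.entryLinearMap ℂ ℂ 1 1)
      simp only [Matrix.entryLinearMap_apply] at h2 h3
      obtain ⟨a1, a2, a3⟩ := hc X h1
      simp [hb, hcc, hd] at a2 a3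
      apply hX
      ext i j
      fin_cases i <;> fin_cases j <;> simp [*]
    · obtain ⟨X, hX, h1, h2, h3⟩ := exists_common_zero p (Matrix.entryLinearMap ℂ ℂ 0 0)
        (Matrix.entryLinearMap ℂ ℂ 1 0)
      simp only [Matrix.entryLinearMap_apply] at h2 h3
      obtain ⟨a1, a2, a3⟩ := hc X h1
      simp [hb, hcc, h2, h3] at a1 a3
      apply hX
      ext i j
      fin_cases i <;> fin_cases j <;> simp [*]
  · obtain ⟨X, hX, h1, h2, h3⟩ := exists_common_zero p (Matrix.entryLinearMap ℂ ℂ 0 0)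
      (Matrix.entryLinearMap ℂ ℂ 0 1)
    simp only [Matrix.entryLinearMap_apply] at h2 h3
    obtain ⟨a1, a2, a3⟩ := hc X h1
    simp [hb, h2, h3] at a1 a2
    apply hX
    ext i j
    fin_cases i <;> fin_cases j <;> simp [*]

/-- A resolution of the identity of length four is biorthogonal. -/
theorem biorthogonal {κ : Type*} [Fintype κ] [DecidableEq κ] (hκ : Fintype.card κ = 4)
    (g : κ → (Matrix (Fin 2) (Fin 2) ℂ →ₗ[ℂ] ℂ)) (C : κ → Matrix (Fin 2) (Fin 2) ℂ)
    (h : ∀ Y, Y = ∑ l, g l Y • C l) (l m : κ) : g l (C m) = if l = m then 1 else 0 := by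
  have hspan : ⊤ ≤ Submodule.span ℂ (Set.range C) := by
    intro Y _
    rw [h Y]
    exact Submodule.sum_mem _ fun l _ => Submodule.smul_mem _ _ (Submodule.subset_span ⟨l, rfl⟩)
  have hli : LinearIndependent ℂ C :=
    linearIndependent_of_top_le_span_of_card_eq_finrank hspan
      (by simp [Module.finrank_matrix, hκ])
  have e : ∑ l, (g l (C m) - if l = m then 1 else 0) • C l = 0 := by
    simp only [sub_smul, Finset.sum_sub_distrib]
    rw [← h (C m)]
    simp
  have := Fintype.linearIndependent_iff.mp hli _ e l
  exact sub_eq_zero.mp this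

/-- The core: if two functionals kill the identity there is no decomposition of length six. -/
theorem no_decomp_one (f g : Fin 6 → (Matrix (Fin 2) (Fin 2) ℂ →ₗ[ℂ] ℂ))
    (C : Fin 6 → Matrix (Fin 2) (Fin 2) ℂ)
    (h : ∀ X Y, X * Y = ∑ l, (f l X * g l Y) • C l) (i j : Fin 6) (hij : i ≠ j)
    (hi : f i 1 = 0) (hj : f j 1 = 0) : False := by
  obtain ⟨D, hD, hDi, hDj, hD0⟩ := exists_common_zero (f i) (f j) (Matrix.entryLinearMap ℂ ℂ 0 0)
  rw [Matrix.entryLinearMap_apply] at hD0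
  obtain ⟨X, hXj, hN⟩ := exists_noncommuting D hD hD0 (f j)
  let κ := {l : Fin 6 // l ≠ i ∧ l ≠ j}
  have hκ : Fintype.card κ = 4 := by
    revert hij
    clear * -
    revert i j
    decide
  -- restricting sums to `κ`
  have hsum : ∀ F : Fin 6 → Matrix (Fin 2) (Fin 2) ℂ, F i = 0 → F j = 0 →
      ∑ l, F l = ∑ l : κ, F l.1 := by
    intro F h1 h2
    symm
    apply Fintype.sum_of_injective (fun l : κ => l.1) Subtype.val_injective
    · intro l hl
      by_cases e1 : l = i
      · rw [e1, h1]
      · by_cases e2 : l = j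
        · rw [e2, h2]
        · exact absurd ⟨⟨l, e1, e2⟩, rfl⟩ hl
    · intro _; rfl
  have hid : ∀ Y, Y = ∑ l : κ, ((f l.1 1) • g l.1) Y • C l.1 := by
    intro Y
    have := h 1 Y
    rw [hsum _ (by simp [hi]) (by simp [hj]), one_mul] at this
    simpa using this
  have hDY : ∀ Y, D * Y = ∑ l : κ, (f l.1 D * g l.1 Y) • C l.1 := by
    intro Y
    rw [h D Y, hsum _ (by simp [hDi]) (by simp [hDj])]
  have hbi := biorthogonal hκ (fun l : κ => (f l.1 1) • g l.1) (fun l => C l.1) hid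
  have hg0 : ∀ l m : κ, l ≠ m → g l.1 (C m.1) = 0 := by
    intro l m hlm
    have h1 := hbi l m
    have h2 := hbi l l
    simp only [LinearMap.smul_apply, smul_eq_mul, if_neg hlm, if_pos] at h1 h2
    rcases mul_eq_zero.mp h1 with h3 | h3
    · rw [h3] at h2; simp at h2
    · exact h3
  have hDC : ∀ m : κ, D * C m.1 = (f m.1 D * g m.1 (C m.1)) • C m.1 := by
    intro m
    rw [hDY, Finset.sum_eq_single m]
    · intro l _ hl
      simp [hg0 l m hl]
    · simp
  have hgD : ∀ (m : κ) Y, g m.1 (D * Y) = (f m.1 D * g m.1 (C m.1)) * g m.1 Y := by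
    intro m Y
    rw [hDY, map_sum, Finset.sum_eq_single m]
    · rw [map_smul, smul_eq_mul]; ring
    · intro l _ hl
      rw [map_smul, hg0 m l hl.symm, smul_zero]
    · simp
  apply hN
  apply left_mul_eq_zero _ D (C i) (f i X • g i) (f i X • (g i).comp (LinearMap.mulLeft ℂ D))
  intro Y
  have e : (D * X - X * D) * Y =
      ∑ l, f l X • (g l Y • (D * C l) - g l (D * Y) • C l) := by
    rw [sub_mul, mul_assoc, mul_assoc, h X Y, h X (D * Y), Finset.mul_sum,
      ← Finset.sum_sub_distrib]
    refine Finset.sum_congr rfl fun l _ => ?_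
    rw [Matrix.mul_smul, smul_sub, smul_smul, smul_smul]
  rw [e, Finset.sum_eq_single i]
  · simp [smul_sub, smul_smul]
  · intro l _ hl
    by_cases hlj : l = j
    · rw [hlj, hXj, zero_smul]
    · have a1 := hDC ⟨l, hl, hlj⟩
      have a2 := hgD ⟨l, hl, hlj⟩ Y
      simp only at a1 a2
      rw [a1, a2, smul_smul, mul_comm (g l Y), sub_self, smul_zero]
  · simp

theorem no_decomp (f g : Fin 6 → (Matrix (Fin 2) (Fin 2) ℂ →ₗ[ℂ] ℂ))
    (C : Fin 6 → Matrix (Fin 2) (Fin 2) ℂ)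
    (h : ∀ X Y, X * Y = ∑ l, (f l X * g l Y) • C l) : False := by
  obtain ⟨i, j, X, hij, hX, hi, hj⟩ := exists_pair f (by
    intro X hX
    have := h X 1
    simpa [hX] using this)
  have hu : IsUnit X.det := isUnit_iff_ne_zero.mpr hX
  refine no_decomp_one (fun l => (f l).comp (LinearMap.mulLeft ℂ X)) g (fun l => X⁻¹ * C l) ?_ i j
    hij (by simpa using hi) (by simpa using hj)
  intro Z Y
  have := congrArg (fun M => X⁻¹ * M) (h (X * Z) Y)
  simp only [Finset.mul_sum, Matrix.mul_smul] at this
  rw [mul_assoc, Matrix.nonsing_inv_mul_cancel_left _ _ hu] at this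
  simpa using this

/-- The functional on matrices with given coefficients. -/
noncomputable def coeffFun (a : Fin 2 × Fin 2 → ℂ) : Matrix (Fin 2) (Fin 2) ℂ →ₗ[ℂ] ℂ :=
  ∑ p : Fin 2 × Fin 2, a p • Matrix.entryLinearMap ℂ ℂ p.1 p.2

theorem coeffFun_apply (a : Fin 2 × Fin 2 → ℂ) (X : Matrix (Fin 2) (Fin 2) ℂ) :
    coeffFun a X = ∑ p : Fin 2 × Fin 2, a p * X p.1 p.2 := by
  simp [coeffFun]

theorem no_six (a b c : Fin 6 → Fin 2 × Fin 2 → ℂ)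
    (h : ∀ i j k, Phi3 i j k = ∑ l, a l i * b l j * c l k) : False := by
  apply no_decomp (fun l => coeffFun (a l)) (fun l => coeffFun (b l))
    (fun l => Matrix.of fun i k => c l (k, i))
  intro X Y
  ext i k
  have e : ∑ p : Fin 2 × Fin 2, ∑ q : Fin 2 × Fin 2, X p.1 p.2 * Y q.1 q.2 * Phi3 p q (k, i)
      = (X * Y) i k := by
    fin_cases i <;> fin_cases k <;>
      simp [Phi3, Fintype.sum_prod_type, Fin.sum_univ_two, Matrix.mul_apply]
  rw [← e]
  simp only [h, coeffFun_apply, Matrix.sum_apply, Matrix.smul_apply, Matrix.of_apply, smul_eq_mul,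
    Finset.mul_sum, Finset.sum_mul]
  rw [Finset.sum_comm' (t' := Finset.univ) (s' := fun _ => Finset.univ) (by simp)]
  conv_rhs => rw [Finset.sum_comm]
  refine Finset.sum_congr rfl fun p _ => ?_
  conv_rhs => rw [Finset.sum_comm]
  refine Finset.sum_congr rfl fun q _ => ?_
  refine Finset.sum_congr rfl fun l _ => ?_
  ring

/-- Strassen's decomposition. -/
theorem strassen : ∃ (a b c : Fin 7 → Fin 2 × Fin 2 → ℂ),
    ∀ i j k, Phi3 i j k = ∑ l, a l i * b l j * c l k := by
  refine ⟨fun l p => (![!![1, 0; 0, 1], !![0, 0; 1, 1], !![1, 0; 0, 0], !![0, 0; 0, 1],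
      !![1, 1; 0, 0], !![-1, 0; 1, 0], !![0, 1; 0, -1]] : Fin 7 → Matrix (Fin 2) (Fin 2) ℂ) l p.1 p.2,
    fun l p => (![!![1, 0; 0, 1], !![1, 0; 0, 0], !![0, 1; 0, -1], !![-1, 0; 1, 0],
      !![0, 0; 0, 1], !![1, 1; 0, 0], !![0, 0; 1, 1]] : Fin 7 → Matrix (Fin 2) (Fin 2) ℂ) l p.1 p.2,
    fun l p => (![!![1, 0; 0, 1], !![0, 0; 1, -1], !![0, 1; 0, 1], !![1, 0; 1, 0],
      !![-1, 1; 0, 0], !![0, 0; 0, 1], !![1, 0; 0, 0]] : Fin 7 → Matrix (Fin 2) (Fin 2) ℂ) l p.2 p.1,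
    ?_⟩
  rintro ⟨i, i'⟩ ⟨j, j'⟩ ⟨k, k'⟩
  fin_cases i <;> fin_cases i' <;> fin_cases j <;> fin_cases j' <;> fin_cases k <;>
    fin_cases k' <;> simp [Phi3, Fin.sum_univ_succ]

/-- The triangle of three EPR pairs has tensor rank exactly 7. -/
theorem trank_Phi3 : trank Phi3 = 7 := by
  unfold trank
  apply le_antisymm
  · exact Nat.sInf_le strassen
  · refine le_csInf ⟨7, strassen⟩ ?_
    rintro r ⟨a, b, c, h⟩
    by_contra hr
    have hr6 : r ≤ 6 := by omega
    refine no_six (fun l p => if hl : l.1 < r then a ⟨l.1, hl⟩ p else 0)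
      (fun l p => if hl : l.1 < r then b ⟨l.1, hl⟩ p else 0)
      (fun l p => if hl : l.1 < r then c ⟨l.1, hl⟩ p else 0) ?_
    intro i j k
    rw [h]
    apply Fintype.sum_of_injective (Fin.castLE hr6) (Fin.castLE_injective hr6)
    · intro l hl
      have : ¬ l.1 < r := fun h' => hl ⟨⟨l.1, h'⟩, rfl⟩
      simp [this]
    · intro l
      simp
end

section
/- The tensor rank of the N×N matrix multiplication tensor ⟨N,N,N⟩ is at least N² (in fact at least 2N² − 1 for N ≥ 1 over ℂ). In particular, rk(⟨N,N,N⟩) > N² for N ≥ 2. -/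
/-- The N×N matrix multiplication tensor ⟨N,N,N⟩ = Σ E_ij ⊗ E_jk ⊗ E_ki. -/
def MMT (N : ℕ) : (Fin N × Fin N) → (Fin N × Fin N) → (Fin N × Fin N) → ℂ :=
  fun p q r => if p.2 = q.1 ∧ q.2 = r.1 ∧ r.2 = p.1 then 1 else 0

open Module

lemma orth_card {ι : Type*} [Fintype ι] [DecidableEq ι] (U V : Submodule ℂ (ι → ℂ))
    (h : ∀ u ∈ U, ∀ v ∈ V, ∑ i, u i * v i = 0) :
    finrank ℂ U + finrank ℂ V ≤ Fintype.card ι := by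
  have h1 := Subspace.finrank_add_finrank_dualAnnihilator_eq U
  have h2 : V.map (dotProductEquiv ℂ ι).toLinearMap ≤ U.dualAnnihilator := by
    rintro _ ⟨v, hv, rfl⟩
    rw [Submodule.mem_dualAnnihilator]
    intro u hu
    have := h u hu v hv
    simpa [dotProduct, mul_comm] using this
  have h3 := Submodule.finrank_mono h2
  rw [LinearEquiv.finrank_map_eq] at h3
  rw [finrank_fintype_fun_eq_card] at h1
  omega

/-- orthogonality for ranges of linear maps -/
lemma orth_range {ι A B : Type*} [Fintype ι] [DecidableEq ι] [AddCommGroup A] [Module ℂ A]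
    [AddCommGroup B] [Module ℂ B] (p : A →ₗ[ℂ] (ι → ℂ)) (q : B →ₗ[ℂ] (ι → ℂ))
    (h : ∀ a b, ∑ i, p a i * q b i = 0) :
    finrank ℂ (LinearMap.range p) + finrank ℂ (LinearMap.range q) ≤ Fintype.card ι := by
  apply orth_card
  rintro _ ⟨a, rfl⟩ _ ⟨b, rfl⟩
  exact h a b

/-- joint evaluation of functionals indexed by a finset -/
noncomputable def evalF {ι V : Type*} [AddCommGroup V] [Module ℂ V] (f : ι → V →ₗ[ℂ] ℂ)
    (S : Finset ι) : V →ₗ[ℂ] (S → ℂ) := LinearMap.pi fun l : S => f l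

lemma evalF_apply {ι V : Type*} [AddCommGroup V] [Module ℂ V] (f : ι → V →ₗ[ℂ] ℂ)
    (S : Finset ι) (v : V) (l : S) : evalF f S v l = f l v := rfl

lemma mem_ker_evalF {ι V : Type*} [AddCommGroup V] [Module ℂ V] (f : ι → V →ₗ[ℂ] ℂ)
    (S : Finset ι) (v : V) : v ∈ LinearMap.ker (evalF f S) ↔ ∀ l ∈ S, f l v = 0 := by
  rw [LinearMap.mem_ker, funext_iff]
  simp [evalF_apply]

lemma finrank_ker_evalF {ι V : Type*} [AddCommGroup V] [Module ℂ V] [FiniteDimensional ℂ V]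
    (f : ι → V →ₗ[ℂ] ℂ)
    (S : Finset ι) : finrank ℂ V ≤ finrank ℂ (LinearMap.ker (evalF f S)) + S.card := by
  have h := LinearMap.finrank_range_add_finrank_ker (evalF f S)
  have h2 := Submodule.finrank_le (LinearMap.range (evalF f S))
  simp at h2
  omega

lemma small_support {ι V : Type*} [DecidableEq ι] [AddCommGroup V] [Module ℂ V]
    [FiniteDimensional ℂ V] (f : ι → V →ₗ[ℂ] ℂ) (F : Finset ι) (B : V →ₗ[ℂ] ℂ) (m : ℕ)
    (hB : ∀ u, (F.filter fun l => f l u ≠ 0).card ≤ m → B u = 0)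
    (hm : F.card + finrank ℂ (LinearMap.ker (evalF f F)) < finrank ℂ V + m) (u : V) : B u = 0 := by
  induction hs : (F.filter fun l => f l u ≠ 0).card using Nat.strong_induction_on generalizing u with
  | _ s ih =>
    by_cases hsm : s ≤ m
    · exact hB u (by omega)
    push Not at hsm
    set S := F.filter fun l => f l u ≠ 0 with hS
    have hSne : S.Nonempty := by
      rw [← Finset.card_pos]; omega
    obtain ⟨l0, hl0⟩ := hSne
    have hSF : S ⊆ F := Finset.filter_subset _ _
    have hTc : (insert l0 (F \ S)).card ≤ F.card - s + 1 := by
      refine (Finset.card_insert_le _ _).trans ?_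
      rw [Finset.card_sdiff_of_subset hSF, hs]
    have hsF : s ≤ F.card := hs ▸ Finset.card_le_card hSF
    have h1 := finrank_ker_evalF f (insert l0 (F \ S))
    have hnle : ¬ LinearMap.ker (evalF f (insert l0 (F \ S))) ≤ LinearMap.ker (evalF f F) := by
      intro hle
      have := Submodule.finrank_mono hle
      omega
    obtain ⟨u', hu', hu''⟩ := SetLike.not_le_iff_exists.mp hnle
    rw [mem_ker_evalF] at hu' hu''
    push Not at hu''
    obtain ⟨l1, hl1F, hl1⟩ := hu''
    have hout : ∀ l ∈ F, f l u = 0 → f l u' = 0 := by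
      intro l hl hlu
      apply hu'
      simp [hS, hl, hlu]
    have hl0' : f l0 u' = 0 := hu' _ (by simp)
    have hl1u : f l1 u ≠ 0 := fun h => hl1 (hout l1 hl1F h)
    have e1 : B u' = 0 := by
      refine ih _ ?_ u' rfl
      rw [← hs]
      apply Finset.card_lt_card
      rw [Finset.ssubset_iff_of_subset]
      · exact ⟨l0, hl0, by simp [hl0']⟩
      · intro l hl
        simp only [Finset.mem_filter, hS] at hl ⊢
        exact ⟨hl.1, fun h => hl.2 (hout l hl.1 h)⟩
    have e2 : B (u - (f l1 u / f l1 u') • u') = 0 := by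
      refine ih _ ?_ _ rfl
      rw [← hs]
      apply Finset.card_lt_card
      rw [Finset.ssubset_iff_of_subset]
      · refine ⟨l1, by simp [hS, hl1F, hl1u], ?_⟩
        simp [hl1]
      · intro l hl
        simp only [Finset.mem_filter, hS] at hl ⊢
        refine ⟨hl.1, fun h => hl.2 ?_⟩
        simp [h, hout l hl.1 h]
    simpa [e1] using e2

lemma core {ι Y Z : Type*} [Fintype ι] [DecidableEq ι] [AddCommGroup Y] [Module ℂ Y]
    [AddCommGroup Z] [Module ℂ Z] [FiniteDimensional ℂ Y] [FiniteDimensional ℂ Z] (n : ℕ)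
    (g : ι → Y →ₗ[ℂ] ℂ) (h : ι → Z →ₗ[ℂ] ℂ) (c0 c1 c2 cu : ι → ℂ)
    (F C1 C2 : Finset ι) 
    (hcov : ∀ a : ι → ℂ, ∑ l, a l = ∑ l ∈ F, a l + ∑ l ∈ C1, a l + ∑ l ∈ C2, a l)
    (c0F : ∀ l ∈ F, c0 l = 0) (c1F : ∀ l ∈ F, c1 l = 0) (c2F : ∀ l ∈ F, c2 l = 0)
    (c1C1 : ∀ l ∈ C1, c1 l = 0) (c1C2 : ∀ l ∈ C2, c1 l ≠ 0) (c2C1 : ∀ l ∈ C1, c2 l ≠ 0)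
    (P : (Fin n → ℂ) →ₗ[ℂ] Y) (R : (Fin n → ℂ) →ₗ[ℂ] Z)
    (hP : ∀ η z, ∑ l, c2 l * g l (P η) * h l z = 0)
    (hR : ∀ y θ, ∑ l, c1 l * g l y * h l (R θ) = 0)
    (b : ℂ) (hb : b ≠ 0)
    (hu : ∀ η θ, ∑ l, cu l * g l (P η) * h l (R θ) = b * ∑ i, η i * θ i)
    (hnd : ∀ z, (∀ y, ∑ l, c0 l * g l y * h l z = 0) → z = 0) :
    n + finrank ℂ Z + finrank ℂ (LinearMap.range (evalF g C2)) ≤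
      (F.filter fun l => cu l ≠ 0).card + C1.card + C2.card +
        finrank ℂ (LinearMap.range (evalF h C2)) := by
  -- first bound
  have b1 : finrank ℂ (LinearMap.range (evalF g C1 ∘ₗ P)) + finrank ℂ Z ≤
      C1.card + finrank ℂ (LinearMap.range (evalF h C2)) := by
    have h1 := LinearMap.finrank_range_add_finrank_ker (evalF h C2)
    let q : LinearMap.ker (evalF h C2) →ₗ[ℂ] (C1 → ℂ) :=
      (evalF (fun l => c2 l • h l) C1) ∘ₗ (LinearMap.ker (evalF h C2)).subtype
    have hq : Function.Injective q := by
      rw [← LinearMap.ker_eq_bot, LinearMap.ker_eq_bot']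
      rintro ⟨z, hz⟩ hqz
      rw [mem_ker_evalF] at hz
      have hz1 : ∀ l ∈ C1, h l z = 0 := by
        intro l hl
        have := congrFun hqz ⟨l, hl⟩
        simpa [q, evalF_apply, c2C1 l hl] using this
      have : z = 0 := by
        apply hnd
        intro y
        rw [hcov, Finset.sum_eq_zero, Finset.sum_eq_zero, Finset.sum_eq_zero]
        · simp
        · intro l hl; simp [hz l hl]
        · intro l hl; simp [hz1 l hl]
        · intro l hl; simp [c0F l hl]
      simp [this]
    have h2 := LinearMap.finrank_range_of_inj hq
    have h3 := orth_range (evalF g C1 ∘ₗ P) q (by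
      rintro η ⟨z, hz⟩
      rw [mem_ker_evalF] at hz
      have := hP η z
      rw [hcov, Finset.sum_eq_zero (s := F), Finset.sum_eq_zero (s := C2), zero_add, add_zero,
        ← Finset.sum_coe_sort] at this
      · rw [← this]
        refine Finset.sum_congr rfl fun l _ => ?_
        simp [q, evalF_apply]; ring
      · intro l hl; simp [hz l hl]
      · intro l hl; simp [c2F l hl])
    simp only [Fintype.card_coe] at h3
    omega
  have b2 : finrank ℂ (LinearMap.range (evalF h C2 ∘ₗ R)) +
      finrank ℂ (LinearMap.range (evalF g C2)) ≤ C2.card := by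
    have h3 := orth_range (evalF g C2) (evalF (fun l => c1 l • h l) C2 ∘ₗ R) (by
      intro y θ
      have := hR y θ
      rw [hcov, Finset.sum_eq_zero (s := F), Finset.sum_eq_zero (s := C1), zero_add, zero_add,
        ← Finset.sum_coe_sort] at this
      · rw [← this]
        refine Finset.sum_congr rfl fun l _ => ?_
        simp [evalF_apply]; ring
      · intro l hl; simp [c1C1 l hl]
      · intro l hl; simp [c1F l hl])
    have h4 : LinearMap.ker (evalF (fun l => c1 l • h l) C2 ∘ₗ R) =
        LinearMap.ker (evalF h C2 ∘ₗ R) := by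
      ext θ
      rw [LinearMap.ker_comp, LinearMap.ker_comp, Submodule.mem_comap, Submodule.mem_comap,
        mem_ker_evalF, mem_ker_evalF]
      refine forall₂_congr fun l hl => ?_
      simp [c1C2 l hl]
    have h5 := LinearMap.finrank_range_add_finrank_ker (evalF (fun l => c1 l • h l) C2 ∘ₗ R)
    have h6 := LinearMap.finrank_range_add_finrank_ker (evalF h C2 ∘ₗ R)
    rw [h4] at h5
    simp only [Fintype.card_coe] at h3
    omega
  -- final bound
  have b3 : n ≤ (F.filter fun l => cu l ≠ 0).card +
      finrank ℂ (LinearMap.range (evalF g C1 ∘ₗ P)) +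
      finrank ℂ (LinearMap.range (evalF h C2 ∘ₗ R)) := by
    have h1 := LinearMap.finrank_range_add_finrank_ker (evalF g C1 ∘ₗ P)
    have h2 := LinearMap.finrank_range_add_finrank_ker (evalF h C2 ∘ₗ R)
    let K := LinearMap.ker (evalF g C1 ∘ₗ P)
    have h3 := finrank_ker_evalF (fun l => g l ∘ₗ P ∘ₗ K.subtype) (F.filter fun l => cu l ≠ 0)
    let K' := LinearMap.ker
      (evalF (fun l => g l ∘ₗ P ∘ₗ K.subtype) (F.filter fun l => cu l ≠ 0))
    have h4 := orth_card (K'.map K.subtype) (LinearMap.ker (evalF h C2 ∘ₗ R)) (by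
      rintro _ ⟨⟨η, hη⟩, hη', rfl⟩ θ hθ
      have hη'' := (mem_ker_evalF _ _ _).1 hη'
      rw [LinearMap.ker_comp, Submodule.mem_comap, mem_ker_evalF] at hθ
      have hη2 : ∀ l ∈ C1, g l (P η) = 0 := by
        have : η ∈ LinearMap.ker (evalF g C1 ∘ₗ P) := hη
        rwa [LinearMap.ker_comp, Submodule.mem_comap, mem_ker_evalF] at this
      have := hu η θ
      rw [hcov, Finset.sum_eq_zero, Finset.sum_eq_zero, Finset.sum_eq_zero] at this
      · simpa [hb] using this.symm
      · intro l hl; simp [hθ l hl]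
      · intro l hl; simp [hη2 l hl]
      · intro l hl
        by_cases hc : cu l = 0
        · simp [hc]
        · have := hη'' l (by simp [hl, hc])
          simp at this
          simp [this])
    have h5 : finrank ℂ (K'.map K.subtype) = finrank ℂ K' :=
      Submodule.finrank_map_subtype_eq _ _
    have hK : finrank ℂ K = finrank ℂ (LinearMap.ker (evalF g C1 ∘ₗ P)) := rfl
    have hK' : finrank ℂ K' = finrank ℂ (LinearMap.ker
      (evalF (fun l => g l ∘ₗ P ∘ₗ K.subtype) (F.filter fun l => cu l ≠ 0))) := rfl
    rw [h5] at h4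
    rw [finrank_fin_fun] at h1 h2
    rw [Fintype.card_fin] at h4
    omega
  omega

lemma nd_right {n : ℕ} (x0 y : Matrix (Fin n) (Fin n) ℂ) (h0 : x0.det ≠ 0)
    (h : ∀ z, (x0 * y * z).trace = 0) : y = 0 := by
  have h1 : x0 * y = 0 := by
    rw [Matrix.ext_iff_trace_mul_right]
    intro z; simp [h z]
  have hu : IsUnit x0.det := isUnit_iff_ne_zero.2 h0
  calc y = x0⁻¹ * (x0 * y) := by rw [Matrix.nonsing_inv_mul_cancel_left _ _ hu]
    _ = 0 := by rw [h1, mul_zero]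

lemma nd_left {n : ℕ} (x0 z : Matrix (Fin n) (Fin n) ℂ) (h0 : x0.det ≠ 0)
    (h : ∀ y, (x0 * y * z).trace = 0) : z = 0 := by
  have h1 : z * x0 = 0 := by
    rw [Matrix.ext_iff_trace_mul_left]
    intro y
    rw [← mul_assoc, Matrix.trace_mul_comm, ← mul_assoc, h y]; simp
  have hu : IsUnit x0.det := isUnit_iff_ne_zero.2 h0
  calc z = z * x0 * x0⁻¹ := by rw [Matrix.mul_nonsing_inv_cancel_right _ _ hu]
    _ = 0 := by rw [h1, zero_mul]

/-- the linear map `η ↦ ξ ηᵀ` -/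
def vmvR {n : ℕ} (ξ : Fin n → ℂ) : (Fin n → ℂ) →ₗ[ℂ] Matrix (Fin n) (Fin n) ℂ where
  toFun η := Matrix.vecMulVec ξ η
  map_add' _ _ := Matrix.vecMulVec_add _ _ _
  map_smul' _ _ := Matrix.vecMulVec_smul _ _ _

/-- the linear map `η ↦ η ξᵀ` -/
def vmvL {n : ℕ} (ξ : Fin n → ℂ) : (Fin n → ℂ) →ₗ[ℂ] Matrix (Fin n) (Fin n) ℂ where
  toFun η := Matrix.vecMulVec η ξ
  map_add' _ _ := Matrix.add_vecMulVec _ _ _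
  map_smul' _ _ := Matrix.smul_vecMulVec _ _ _

/-- the linear map `u ↦ ζᵀ u ξ` -/
def bil {n : ℕ} (ζ ξ : Fin n → ℂ) : Matrix (Fin n) (Fin n) ℂ →ₗ[ℂ] ℂ where
  toFun u := ζ ⬝ᵥ (u.mulVec ξ)
  map_add' _ _ := by simp [Matrix.add_mulVec, dotProduct_add]
  map_smul' _ _ := by simp [Matrix.smul_mulVec]

lemma bil_ne {n : ℕ} (ζ ξ : Fin n → ℂ) (hζ : ζ ≠ 0) (hξ : ξ ≠ 0) : ∃ u, bil ζ ξ u ≠ 0 := by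
  obtain ⟨i, hi⟩ := Function.ne_iff.1 hζ
  obtain ⟨j, hj⟩ := Function.ne_iff.1 hξ
  refine ⟨Matrix.single i j 1, ?_⟩
  simp only [bil, LinearMap.coe_mk, AddHom.coe_mk]
  rw [Matrix.single_mulVec]
  have : (Function.update (0 : Fin n → ℂ) i (1 * ξ j)) = Pi.single i (1 * ξ j) := rfl
  rw [this, dotProduct_single, one_mul]
  exact mul_ne_zero hi hj

lemma tr_bil {n : ℕ} (ζ ξ η θ : Fin n → ℂ) (u : Matrix (Fin n) (Fin n) ℂ) :
    (u * vmvR ξ η * vmvL ζ θ).trace = bil ζ ξ u * ∑ i, η i * θ i := by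
  simp only [vmvR, vmvL, bil, LinearMap.coe_mk, AddHom.coe_mk]
  rw [Matrix.mul_vecMulVec u, Matrix.vecMulVec_mul_vecMulVec, Matrix.trace_vecMulVec,
    dotProduct_smul, smul_eq_mul, mul_comm, dotProduct_comm]
  rfl

lemma tr_bil' {n : ℕ} (ζ ξ η θ : Fin n → ℂ) (u : Matrix (Fin n) (Fin n) ℂ) :
    (u * vmvR ξ θ * vmvL ζ η).trace = bil ζ ξ u * ∑ i, η i * θ i := by
  rw [tr_bil]; simp [mul_comm]

lemma key5 {n : ℕ} {ι : Type*} [Fintype ι] [DecidableEq ι]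
    (f g h : ι → Matrix (Fin n) (Fin n) ℂ →ₗ[ℂ] ℂ)
    (hT : ∀ x y z, (x * y * z).trace = ∑ l, f l x * g l y * h l z)
    (F C1 C2 : Finset ι)
    (hcov : ∀ a : ι → ℂ, ∑ l, a l = ∑ l ∈ F, a l + ∑ l ∈ C1, a l + ∑ l ∈ C2, a l)
    (x0 x1 x2 : Matrix (Fin n) (Fin n) ℂ)
    (d0 : x0.det ≠ 0) (d1 : x1.det = 0) (d2 : x2.det = 0)
    (c0F : ∀ l ∈ F, f l x0 = 0) (c1F : ∀ l ∈ F, f l x1 = 0) (c2F : ∀ l ∈ F, f l x2 = 0)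
    (c1C1 : ∀ l ∈ C1, f l x1 = 0) (c1C2 : ∀ l ∈ C2, f l x1 ≠ 0) (c2C1 : ∀ l ∈ C1, f l x2 ≠ 0) :
    ∃ B : Matrix (Fin n) (Fin n) ℂ →ₗ[ℂ] ℂ, (∃ u, B u ≠ 0) ∧ ∀ u, B u ≠ 0 →
      n + n ^ 2 ≤ (F.filter fun l => f l u ≠ 0).card + C1.card + C2.card := by
  have hfr : finrank ℂ (Matrix (Fin n) (Fin n) ℂ) = n ^ 2 := by
    simp [Module.finrank_matrix, sq]
  rcases le_total (finrank ℂ (LinearMap.range (evalF h C2)))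
    (finrank ℂ (LinearMap.range (evalF g C2))) with hle | hle
  · obtain ⟨ξ, hξ, hξ2⟩ := Matrix.exists_mulVec_eq_zero_iff.2 d2
    obtain ⟨ζ, hζ, hζ1⟩ := Matrix.exists_vecMul_eq_zero_iff.2 d1
    refine ⟨bil ζ ξ, bil_ne ζ ξ hζ hξ, fun u hu => ?_⟩
    have := core n g h (fun l => f l x0) (fun l => f l x1) (fun l => f l x2) (fun l => f l u)
      F C1 C2 hcov c0F c1F c2F c1C1 c1C2 c2C1 (vmvR ξ) (vmvL ζ)
      (by
        intro η z
        rw [← hT]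
        simp [vmvR, Matrix.mul_vecMulVec, hξ2])
      (by
        intro y θ
        rw [← hT, Matrix.trace_mul_cycle]
        simp [vmvL, Matrix.vecMulVec_mul, hζ1])
      (bil ζ ξ u) hu
      (by
        intro η θ
        rw [← hT, tr_bil])
      (by
        intro z hz
        apply nd_left x0 z d0
        intro y
        rw [hT]; exact hz y)
    omega
  · obtain ⟨ξ, hξ, hξ1⟩ := Matrix.exists_mulVec_eq_zero_iff.2 d1
    obtain ⟨ζ, hζ, hζ2⟩ := Matrix.exists_vecMul_eq_zero_iff.2 d2
    refine ⟨bil ζ ξ, bil_ne ζ ξ hζ hξ, fun u hu => ?_⟩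
    have hT' : ∀ x y z, ∑ l, f l x * h l z * g l y = (x * y * z).trace := by
      intro x y z
      rw [hT]
      exact Finset.sum_congr rfl fun l _ => by ring
    have := core n h g (fun l => f l x0) (fun l => f l x1) (fun l => f l x2) (fun l => f l u)
      F C1 C2 hcov c0F c1F c2F c1C1 c1C2 c2C1 (vmvL ζ) (vmvR ξ)
      (by
        intro η z
        rw [hT', Matrix.trace_mul_cycle]
        simp [vmvL, Matrix.vecMulVec_mul, hζ2])
      (by
        intro y θ
        rw [hT']
        simp [vmvR, Matrix.mul_vecMulVec, hξ1])
      (bil ζ ξ u) hu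
      (by
        intro η θ
        rw [hT', tr_bil'])
      (by
        intro z hz
        apply nd_right x0 z d0
        intro y
        rw [← hT']; exact hz y)
    omega

lemma pencil {n : ℕ} {ι : Type*} [Fintype ι] [DecidableEq ι]
    (f g h : ι → Matrix (Fin n) (Fin n) ℂ →ₗ[ℂ] ℂ)
    (hT : ∀ x y z, (x * y * z).trace = ∑ l, f l x * g l y * h l z)
    (F C : Finset ι) (hFC : ∀ l, l ∈ F ∨ l ∈ C)
    (x0 : Matrix (Fin n) (Fin n) ℂ) (d0 : x0.det ≠ 0)
    (c0F : ∀ l ∈ F, f l x0 = 0) (c0C : ∀ l ∈ C, f l x0 ≠ 0)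
    (hdet : ∀ x, (∀ l ∈ F, f l x = 0) → (∃ l ∈ C, f l x = 0) → x.det = 0) :
    ∃ x, (∀ l ∈ F, f l x = 0) ∧ (C.image fun l => f l x / f l x0).card ≤ n ∧
      finrank ℂ (LinearMap.ker (evalF f F)) ≤ (C.image fun l => f l x / f l x0).card := by
  classical
  obtain ⟨x, hxF, hx⟩ := Module.Dual.exists_forall_mem_ne_zero_of_forall_exists
    (LinearMap.ker (evalF f F))
    (fun p : {p : ι × ι // ∃ y ∈ LinearMap.ker (evalF f F),
        (f p.2 x0 • f p.1 - f p.1 x0 • f p.2) y ≠ 0} =>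
      (f p.1.2 x0 • f p.1.1 - f p.1.1 x0 • f p.1.2 : Module.Dual ℂ (Matrix (Fin n) (Fin n) ℂ)))
    (fun p => p.2)
  rw [mem_ker_evalF] at hxF
  have hgen : ∀ l ∈ C, ∀ l' ∈ C, f l x / f l x0 = f l' x / f l' x0 →
      ∀ y ∈ LinearMap.ker (evalF f F), f l' y = 0 → f l y = 0 := by
    intro l hl l' hl' heq y hy hy0
    by_contra hne
    refine hx ⟨(l, l'), y, hy, ?_⟩ ?_
    · simp [hy0, hne, c0C l' hl']
    · have h1 := c0C l hl
      have h2 := c0C l' hl'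
      rw [div_eq_div_iff h1 h2] at heq
      simp
      linear_combination heq
  refine ⟨x, hxF, ?_, ?_⟩
  · have hsub : (C.image fun l => f l x / f l x0) ⊆ (x0⁻¹ * x).charpoly.roots.toFinset := by
      intro c hc
      rw [Finset.mem_image] at hc
      obtain ⟨l, hl, rfl⟩ := hc
      rw [Multiset.mem_toFinset, Polynomial.mem_roots (Matrix.charpoly_monic _).ne_zero,
        Polynomial.IsRoot, Matrix.eval_charpoly]
      have hz : ((f l x / f l x0) • x0 - x).det = 0 := by
        apply hdet
        · intro k hk; simp [c0F k hk, hxF k hk]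
        · exact ⟨l, hl, by simp [c0C l hl]⟩
      have hu : IsUnit x0.det := isUnit_iff_ne_zero.2 d0
      have : (Matrix.scalar (Fin n)) (f l x / f l x0) - x0⁻¹ * x =
          x0⁻¹ * ((f l x / f l x0) • x0 - x) := by
        rw [mul_sub, mul_smul_comm, Matrix.nonsing_inv_mul _ hu]
        congr 1
        rw [Matrix.scalar_apply, Matrix.smul_one_eq_diagonal]
      rw [this, Matrix.det_mul, hz, mul_zero]
    refine (Finset.card_le_card hsub).trans ((Multiset.toFinset_card_le _).trans
      ((Polynomial.card_roots' _).trans ?_))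
    rw [Matrix.charpoly_natDegree_eq_dim, Fintype.card_fin]
  · set V := C.image fun l => f l x / f l x0 with hV
    have hrep : ∀ v : V, ∃ l ∈ C, f l x / f l x0 = v := fun v => Finset.mem_image.1 v.2
    choose rep hrepC hrepv using hrep
    let q : LinearMap.ker (evalF f F) →ₗ[ℂ] (V → ℂ) :=
      (LinearMap.pi fun v : V => f (rep v)) ∘ₗ (LinearMap.ker (evalF f F)).subtype
    have hq : Function.Injective q := by
      rw [← LinearMap.ker_eq_bot, LinearMap.ker_eq_bot']
      rintro ⟨y, hy⟩ hqy
      have hyC : ∀ l ∈ C, f l y = 0 := by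
        intro l hl
        let v : V := ⟨f l x / f l x0, Finset.mem_image_of_mem _ hl⟩
        refine hgen l hl (rep v) (hrepC v) (hrepv v).symm y hy ?_
        exact congrFun hqy v
      have hyF := (mem_ker_evalF _ _ _).1 hy
      have : y = 0 := by
        rw [Matrix.ext_iff_trace_mul_right]
        intro z
        have h1 := hT y 1 z
        rw [Finset.sum_eq_zero] at h1
        · simpa using h1
        · intro l _
          have : f l y = 0 := (hFC l).elim (hyF l) (hyC l)
          simp [this]
      simp [this]
    have := LinearMap.finrank_le_finrank_of_injective hq
    simpa using this

lemma main_bound {n r : ℕ} (hn : 1 ≤ n)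
    (f g h : Fin r → Matrix (Fin n) (Fin n) ℂ →ₗ[ℂ] ℂ)
    (hT : ∀ x y z, (x * y * z).trace = ∑ l, f l x * g l y * h l z) :
    2 * n ^ 2 - 1 ≤ r := by
  classical
  by_contra hr
  push Not at hr
  have hD : 1 ≤ n ^ 2 := Nat.one_le_pow _ _ hn
  have hfr : finrank ℂ (Matrix (Fin n) (Fin n) ℂ) = n ^ 2 := by
    simp [Module.finrank_matrix, sq]
  -- choose `x0`
  let Z : Matrix (Fin n) (Fin n) ℂ → Finset (Fin r) := fun x => Finset.univ.filter fun l => f l x = 0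
  obtain ⟨x0, d0, hmax⟩ : ∃ x0 : Matrix (Fin n) (Fin n) ℂ, x0.det ≠ 0 ∧
      ∀ x : Matrix (Fin n) (Fin n) ℂ, x.det ≠ 0 → (Z x).card ≤ (Z x0).card := by
    let S : Finset (Finset (Fin r)) := Finset.univ.filter fun s => ∃ x, x.det ≠ 0 ∧ Z x = s
    have hS : S.Nonempty := ⟨Z 1, by simp only [S, Finset.mem_filter, Finset.mem_univ, true_and]; exact ⟨1, by simp, rfl⟩⟩
    obtain ⟨s, hs, hsm⟩ := Finset.exists_max_image S Finset.card hS
    obtain ⟨x0, d0, rfl⟩ := (Finset.mem_filter.1 hs).2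
    refine ⟨x0, d0, fun x hx => hsm _ ?_⟩
    simp only [S, Finset.mem_filter, Finset.mem_univ, true_and]
    exact ⟨x, hx, rfl⟩
  set F := Z x0 with hF
  set C := Finset.univ \ F with hC
  have c0F : ∀ l ∈ F, f l x0 = 0 := fun l hl => (Finset.mem_filter.1 hl).2
  have c0C : ∀ l ∈ C, f l x0 ≠ 0 := by
    intro l hl h0
    simp [hC, hF, Z, h0] at hl
  have hFC : ∀ l, l ∈ F ∨ l ∈ C := by
    intro l
    by_cases hl : l ∈ F
    · exact Or.inl hl
    · right; simp [hC, hl]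
  have hdet : ∀ x, (∀ l ∈ F, f l x = 0) → (∃ l ∈ C, f l x = 0) → x.det = 0 := by
    rintro x hx ⟨l, hl, hlx⟩
    by_contra hd
    have h1 := hmax x hd
    have h2 : insert l F ⊆ Z x := by
      intro k hk
      rw [Finset.mem_insert] at hk
      rcases hk with rfl | hk
      · simp [Z, hlx]
      · simp [Z, hx k hk]
    have h3 := Finset.card_le_card h2
    have h4 : l ∉ F := by simpa [hC] using hl
    rw [Finset.card_insert_of_notMem h4] at h3
    omega
  have hcard : F.card + C.card = r := by
    rw [add_comm, hC, Finset.card_sdiff_add_card_eq_card (Finset.subset_univ F),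
      Finset.card_univ, Fintype.card_fin]
  have hCD : n ^ 2 ≤ C.card := by
    have hinj : Function.Injective (evalF g C) := by
      rw [← LinearMap.ker_eq_bot, LinearMap.ker_eq_bot']
      intro y hy
      have hy' := (mem_ker_evalF g C y).1 hy
      apply nd_right x0 y d0
      intro z
      rw [hT]
      refine Finset.sum_eq_zero fun l _ => ?_
      rcases hFC l with hl | hl
      · simp [c0F l hl]
      · simp [hy' l hl]
    have := LinearMap.finrank_le_finrank_of_injective hinj
    rw [hfr] at this
    simpa using this
  have ha := finrank_ker_evalF f F
  rw [hfr] at ha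
  obtain ⟨x, hxF, hVn, haV⟩ := pencil f g h hT F C hFC x0 d0 c0F c0C hdet
  set V := C.image fun l => f l x / f l x0 with hV
  obtain ⟨c, hc, d, hd, hcd⟩ := Finset.one_lt_card.1 (show 1 < V.card by omega)
  have hsing : ∀ c ∈ V, (x - c • x0).det = 0 := by
    intro c hc
    obtain ⟨l, hl, rfl⟩ := Finset.mem_image.1 hc
    apply hdet
    · intro k hk; simp [c0F k hk, hxF k hk]
    · exact ⟨l, hl, by simp [c0C l hl]⟩
  have heq : ∀ l ∈ C, ∀ c, f l (x - c • x0) = 0 ↔ f l x / f l x0 = c := by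
    intro l hl c
    rw [div_eq_iff (c0C l hl)]
    simp [sub_eq_zero]
  obtain ⟨B, ⟨u, hu⟩, hB⟩ := key5 f g h hT F (C.filter fun l => f l x / f l x0 = c)
    (C.filter fun l => ¬ f l x / f l x0 = c)
    (by
      intro a
      rw [add_assoc, Finset.sum_filter_add_sum_filter_not, add_comm, hC,
        Finset.sum_sdiff (Finset.subset_univ F)])
    x0 (x - c • x0) (x - d • x0) d0 (hsing c hc) (hsing d hd) c0F
    (by intro k hk; simp [c0F k hk, hxF k hk])
    (by intro k hk; simp [c0F k hk, hxF k hk])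
    (by
      intro l hl
      rw [Finset.mem_filter] at hl
      rw [heq l hl.1]; exact hl.2)
    (by
      intro l hl
      rw [Finset.mem_filter] at hl
      rw [Ne, heq l hl.1]; exact hl.2)
    (by
      intro l hl
      rw [Finset.mem_filter] at hl
      rw [Ne, heq l hl.1, hl.2]; exact hcd)
  have hCC := Finset.card_filter_add_card_filter_not (s := C) (fun l => f l x / f l x0 = c)
  apply hu
  refine small_support f F B
    (finrank ℂ (LinearMap.ker (evalF f F)) - 1 - (C.card - n ^ 2)) ?_ ?_ u
  · intro u hu
    by_contra hne
    have := hB u hne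
    omega
  · rw [hfr]
    omega

/-- the functional on matrices with given coefficients -/
noncomputable def coefF {n : ℕ} (a : Fin n × Fin n → ℂ) : Matrix (Fin n) (Fin n) ℂ →ₗ[ℂ] ℂ where
  toFun x := ∑ p, a p * x p.1 p.2
  map_add' x y := by simp [mul_add, Finset.sum_add_distrib]
  map_smul' c x := by
    simp only [Matrix.smul_apply, smul_eq_mul, RingHom.id_apply, Finset.mul_sum]
    exact Finset.sum_congr rfl fun _ _ => by ring

lemma trace_MMT (n : ℕ) (x y z : Matrix (Fin n) (Fin n) ℂ) :
    (x * y * z).trace = ∑ p, ∑ q, ∑ s, MMT n p q s * (x p.1 p.2 * y q.1 q.2 * z s.1 s.2) := by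
  simp only [Fintype.sum_prod_type, MMT, ite_mul, one_mul, zero_mul, ite_and]
  simp [Matrix.trace, Matrix.mul_apply, Finset.sum_mul]
  refine Finset.sum_congr rfl fun i _ => ?_
  rw [Finset.sum_comm]

lemma trank_set_nonempty {ι₁ ι₂ ι₃ : Type*} [Fintype ι₁] [Fintype ι₂] [Fintype ι₃]
    (φ : ι₁ → ι₂ → ι₃ → ℂ) : ∃ (r : ℕ) (a : Fin r → ι₁ → ℂ) (b : Fin r → ι₂ → ℂ)
      (c : Fin r → ι₃ → ℂ), ∀ i j k, φ i j k = ∑ l, a l i * b l j * c l k := by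
  classical
  let e := (Fintype.equivFin (ι₁ × ι₂ × ι₃)).symm
  refine ⟨_, fun l i => if (e l).1 = i then φ (e l).1 (e l).2.1 (e l).2.2 else 0,
    fun l j => if (e l).2.1 = j then 1 else 0, fun l k => if (e l).2.2 = k then 1 else 0, ?_⟩
  intro i j k
  rw [e.sum_comp (fun t : ι₁ × ι₂ × ι₃ => (if t.1 = i then φ t.1 t.2.1 t.2.2 else 0) *
    (if t.2.1 = j then 1 else 0) * (if t.2.2 = k then 1 else 0))]
  simp [Fintype.sum_prod_type]

lemma trank_MMT_bound (N : ℕ) (hN : 1 ≤ N) : 2 * N ^ 2 - 1 ≤ trank (MMT N) := by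
  unfold trank
  refine le_csInf (trank_set_nonempty (MMT N)) ?_
  rintro r ⟨a, b, c, habc⟩
  refine main_bound hN (fun l => coefF (a l)) (fun l => coefF (b l)) (fun l => coefF (c l)) ?_
  intro x y z
  rw [trace_MMT]
  simp only [habc, coefF, LinearMap.coe_mk, AddHom.coe_mk]
  calc _ = ∑ p : Fin N × Fin N, ∑ q : Fin N × Fin N, ∑ s : Fin N × Fin N, ∑ l,
        a l p * x p.1 p.2 * (b l q * y q.1 q.2) * (c l s * z s.1 s.2) := by
        refine Finset.sum_congr rfl fun p _ => Finset.sum_congr rfl fun q _ =>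
          Finset.sum_congr rfl fun s _ => ?_
        rw [Finset.sum_mul]
        exact Finset.sum_congr rfl fun l _ => by ring
    _ = ∑ p : Fin N × Fin N, ∑ q : Fin N × Fin N, ∑ l, ∑ s : Fin N × Fin N,
        a l p * x p.1 p.2 * (b l q * y q.1 q.2) * (c l s * z s.1 s.2) :=
        Finset.sum_congr rfl fun p _ => Finset.sum_congr rfl fun q _ => Finset.sum_comm
    _ = ∑ p : Fin N × Fin N, ∑ l, ∑ q : Fin N × Fin N, ∑ s : Fin N × Fin N,
        a l p * x p.1 p.2 * (b l q * y q.1 q.2) * (c l s * z s.1 s.2) :=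
        Finset.sum_congr rfl fun p _ => Finset.sum_comm
    _ = ∑ l, ∑ p : Fin N × Fin N, ∑ q : Fin N × Fin N, ∑ s : Fin N × Fin N,
        a l p * x p.1 p.2 * (b l q * y q.1 q.2) * (c l s * z s.1 s.2) := Finset.sum_comm
    _ = _ := by
        refine Finset.sum_congr rfl fun l _ => ?_
        rw [Finset.sum_mul_sum, Finset.sum_mul]
        refine Finset.sum_congr rfl fun p _ => ?_
        rw [Finset.sum_mul]
        refine Finset.sum_congr rfl fun q _ => ?_
        rw [Finset.mul_sum]

theorem matmul_tensor_rank_lower_bound (N : ℕ) :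
    N ^ 2 ≤ trank (MMT N) ∧
    (1 ≤ N → 2 * N ^ 2 - 1 ≤ trank (MMT N)) ∧
    (2 ≤ N → N ^ 2 < trank (MMT N)) := by
  refine ⟨?_, trank_MMT_bound N, ?_⟩
  · rcases Nat.eq_zero_or_pos N with rfl | h
    · simp
    · have := trank_MMT_bound N h
      have h1 : 1 ≤ N ^ 2 := Nat.one_le_pow _ _ h
      omega
  · intro h
    have := trank_MMT_bound N (by omega)
    have h1 : 2 * 2 ≤ N ^ 2 := by nlinarith
    omega
end
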